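/- arXiv:1403.5078 — 2 statements merged into one kernel-verified Lean document; each statement's English description precedes it below -/
import Mathlib

section
/- Let â be an n×n real symmetric positive semidefinite matrix of rank l ≤ n−1 whose upper-left (n−1)×(n−1) block is diagonal with â₁₁ ≥ â₂₂ ≥ ⋯ ≥ â_{n−1,n−1}. Then there is a positive constant C₀ such that exactly one of the following two cases holds. CASE 1: â₁₁ ≥ ⋯ ≥ â_{l−1,l−1} ≥ C₀, â_{ll} = ⋯ = â_{n−1,n−1} = 0, â_{in} = 0 for all l ≤ i ≤ n−1, and â_{nn} − Σ_{i=1}^{l−1} â_{in}²/â_{ii} ≥ C₀. CASE 2: â₁₁ ≥ ⋯ ≥ â_{ll} ≥ C₀, â_{l+1,l+1} = ⋯ = â_{n−1,n−1} = 0, â_{in} = 0 for all l+1 ≤ i ≤ n−1, and â_{nn} = Σ_{i=1}^{l} â_{in}²/â_{ii}. -/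
noncomputable section

open Matrix

/-- CASE 1 of Lemma 2.5 (written with 1-based indices `i ↦ i.val + 1`):
`â₁₁ ≥ … ≥ â_{l-1,l-1} ≥ C₀`, `â_{ll} = … = â_{n-1,n-1} = 0`, `â_{in} = 0` for
`l ≤ i ≤ n-1`, and `â_{nn} - Σ_{i=1}^{l-1} â_{in}²/â_{ii} ≥ C₀`. -/
def RankCase1 (n l : ℕ) (C₀ : ℝ) (A : Matrix (Fin n) (Fin n) ℝ) (lst : Fin n) : Prop :=
  (∀ i : Fin n, (i : ℕ) + 1 + 1 ≤ l → C₀ ≤ A i i) ∧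
  (∀ i : Fin n, l ≤ (i : ℕ) + 1 → (i : ℕ) + 1 ≤ n - 1 → A i i = 0) ∧
  (∀ i : Fin n, l ≤ (i : ℕ) + 1 → (i : ℕ) + 1 ≤ n - 1 → A i lst = 0) ∧
  C₀ ≤ A lst lst -
    ∑ i ∈ Finset.univ.filter (fun i : Fin n => (i : ℕ) + 1 + 1 ≤ l), (A i lst) ^ 2 / A i i

/-- CASE 2 of Lemma 2.5: `â₁₁ ≥ … ≥ â_{ll} ≥ C₀`, `â_{l+1,l+1} = … = â_{n-1,n-1} = 0`,
`â_{in} = 0` for `l+1 ≤ i ≤ n-1`, and `â_{nn} = Σ_{i=1}^{l} â_{in}²/â_{ii}`. -/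
def RankCase2 (n l : ℕ) (C₀ : ℝ) (A : Matrix (Fin n) (Fin n) ℝ) (lst : Fin n) : Prop :=
  (∀ i : Fin n, (i : ℕ) + 1 ≤ l → C₀ ≤ A i i) ∧
  (∀ i : Fin n, l + 1 ≤ (i : ℕ) + 1 → (i : ℕ) + 1 ≤ n - 1 → A i i = 0) ∧
  (∀ i : Fin n, l + 1 ≤ (i : ℕ) + 1 → (i : ℕ) + 1 ≤ n - 1 → A i lst = 0) ∧
  A lst lst =
    ∑ i ∈ Finset.univ.filter (fun i : Fin n => (i : ℕ) + 1 ≤ l), (A i lst) ^ 2 / A i i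

/-- A vanishing diagonal entry of a positive semidefinite matrix forces its row to vanish. -/
lemma Matrix.PosSemidef.apply_eq_zero_of_diag_eq_zero {ι : Type*} [Fintype ι] [DecidableEq ι]
    {A : Matrix ι ι ℝ} (hA : A.PosSemidef) {i : ι} (hi : A i i = 0) (j : ι) : A i j = 0 := by
  have h := (hA.dotProduct_mulVec_zero_iff (Pi.single i 1)).1 (by simpa using hi)
  have hj := congrFun h j
  rw [← hA.isHermitian.apply i j]
  simpa using hj

/-- The Schur complement of the diagonal block of an arrowhead matrix with tip `e`. -/
def arrowSchur {ι : Type*} [Fintype ι] [DecidableEq ι] (A : Matrix ι ι ℝ) (e : ι) : ℝ :=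
  A e e - ∑ i ∈ Finset.univ.erase e, A i e ^ 2 / A i i

/-- The pivots of an arrowhead matrix with tip `e`. -/
def arrowPivot {ι : Type*} [Fintype ι] [DecidableEq ι] (A : Matrix ι ι ℝ) (e : ι) : ι → ℝ :=
  Function.update (fun i ↦ A i i) e (arrowSchur A e)

/-- The unipotent factor in the `L D Lᵀ` decomposition of an arrowhead matrix with tip `e`. -/
def arrowFactor {ι : Type*} [DecidableEq ι] (A : Matrix ι ι ℝ) (e : ι) :
    Matrix ι ι ℝ :=
  1 + replicateCol Unit (Pi.single e (1 : ℝ)) *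
    replicateRow Unit (Function.update (fun j ↦ A j e / A j j) e 0)

lemma det_arrowFactor {ι : Type*} [Fintype ι] [DecidableEq ι] (A : Matrix ι ι ℝ) (e : ι) :
    (arrowFactor A e).det = 1 := by
  simp [arrowFactor, det_one_add_replicateCol_mul_replicateRow]

lemma arrowFactor_apply_of_ne {ι : Type*} [DecidableEq ι] (A : Matrix ι ι ℝ)
    {e i : ι} (hi : i ≠ e) (j : ι) : arrowFactor A e i j = (1 : Matrix ι ι ℝ) i j := by
  simp [arrowFactor, mul_apply, hi]

lemma arrowFactor_apply_tip_of_ne {ι : Type*} [DecidableEq ι]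
    (A : Matrix ι ι ℝ) {e j : ι} (hj : j ≠ e) : arrowFactor A e e j = A j e / A j j := by
  simp [arrowFactor, mul_apply, hj, hj.symm]

lemma arrowFactor_apply_tip_tip {ι : Type*} [DecidableEq ι]
    (A : Matrix ι ι ℝ) (e : ι) : arrowFactor A e e e = 1 := by
  simp [arrowFactor, mul_apply]

section Arrowhead

variable {ι : Type*} [Fintype ι] [DecidableEq ι] {A : Matrix ι ι ℝ} {e : ι}

lemma eq_arrowFactor_mul_diagonal_mul (hA : A.PosSemidef)
    (hdiag : ∀ i j, i ≠ e → j ≠ e → i ≠ j → A i j = 0) :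
    A = arrowFactor A e * diagonal (arrowPivot A e) * (arrowFactor A e)ᵀ := by
  have hsymm (i j : ι) : A i j = A j i := by simpa using (hA.isHermitian.apply i j).symm
  have hcol (j : ι) (hj : j ≠ e) : A j e / A j j * A j j = A j e :=
    div_mul_cancel_of_imp fun h ↦ hA.apply_eq_zero_of_diag_eq_zero h e
  ext i j
  rw [mul_apply]
  simp only [mul_diagonal, transpose_apply]
  by_cases hi : i = e
  · subst hi
    by_cases hj : j = i
    · subst hj
      rw [← Finset.add_sum_erase _ _ (Finset.mem_univ j), arrowFactor_apply_tip_tip]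
      have : ∑ x ∈ Finset.univ.erase j,
          arrowFactor A j j x * arrowPivot A j x * arrowFactor A j j x =
          ∑ x ∈ Finset.univ.erase j, A x j ^ 2 / A x x := by
        refine Finset.sum_congr rfl fun x hx ↦ ?_
        have hx := Finset.ne_of_mem_erase hx
        rw [arrowFactor_apply_tip_of_ne A hx, arrowPivot, Function.update_of_ne hx, hcol x hx]
        ring
      rw [this]
      simp [arrowPivot, arrowSchur]
    · simp [arrowFactor_apply_of_ne A hj, one_apply, arrowFactor_apply_tip_of_ne A hj,
        arrowPivot, Function.update_of_ne hj, hcol j hj, hsymm i j]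
  · by_cases hj : j = e
    · subst hj
      simp [arrowFactor_apply_of_ne A hi, one_apply, arrowFactor_apply_tip_of_ne A hi,
        arrowPivot, Function.update_of_ne hi, mul_comm (A i i), hcol i hi]
    · by_cases hij : i = j
      · subst hij
        simp [arrowFactor_apply_of_ne A hi, one_apply, arrowPivot, Function.update_of_ne hi]
      · simp [arrowFactor_apply_of_ne A hi, arrowFactor_apply_of_ne A hj, one_apply, hij,
          hdiag i j hi hj hij]

lemma arrowPivot_nonneg (hA : A.PosSemidef)
    (hdiag : ∀ i j, i ≠ e → j ≠ e → i ≠ j → A i j = 0) (i : ι) : 0 ≤ arrowPivot A e i := by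
  have hU : IsUnit (arrowFactor A e) := by simp [isUnit_iff_isUnit_det, det_arrowFactor]
  have h := hA
  rw [eq_arrowFactor_mul_diagonal_mul hA hdiag, ← conjTranspose_eq_transpose_of_trivial,
    ← star_eq_conjTranspose, hU.posSemidef_star_right_conjugate_iff,
    posSemidef_diagonal_iff] at h
  exact h i

lemma rank_eq_card_arrowPivot_ne_zero (hA : A.PosSemidef)
    (hdiag : ∀ i j, i ≠ e → j ≠ e → i ≠ j → A i j = 0) :
    A.rank = (Finset.univ.filter fun i ↦ arrowPivot A e i ≠ 0).card := by
  conv_lhs => rw [eq_arrowFactor_mul_diagonal_mul hA hdiag]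
  rw [rank_mul_eq_left_of_isUnit_det _ _ (by simp [det_arrowFactor]),
    rank_mul_eq_right_of_isUnit_det _ _ (by simp [det_arrowFactor]), rank_diagonal,
    Fintype.card_subtype]

lemma rank_eq_card_add_ite_arrowSchur (hA : A.PosSemidef)
    (hdiag : ∀ i j, i ≠ e → j ≠ e → i ≠ j → A i j = 0) :
    A.rank = (Finset.univ.filter fun i ↦ i ≠ e ∧ A i i ≠ 0).card +
      if arrowSchur A e = 0 then 0 else 1 := by
  rw [rank_eq_card_arrowPivot_ne_zero hA hdiag, Finset.card_filter, Finset.card_filter,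
    ← Finset.sum_erase_add _ _ (Finset.mem_univ e),
    ← Finset.sum_erase (a := e) (f := fun i ↦ if i ≠ e ∧ A i i ≠ 0 then 1 else 0) _ (by simp)]
  congr 1
  · refine Finset.sum_congr rfl fun i hi ↦ ?_
    have hi := Finset.ne_of_mem_erase hi
    simp [arrowPivot, hi]
  · simp [arrowPivot]

lemma arrowSchur_eq_of_support (s : Finset ι)
    (hs : ∀ i, i ∈ s ↔ i ≠ e ∧ A i i ≠ 0) :
    arrowSchur A e = A e e - ∑ i ∈ s, A i e ^ 2 / A i i := by
  rw [arrowSchur, Finset.sum_subset (s₁ := s) (s₂ := Finset.univ.erase e)]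
  · intro i hi
    simp [((hs i).1 hi).1]
  · intro i hi his
    have : A i i = 0 := by
      by_contra h
      exact his ((hs i).2 ⟨Finset.ne_of_mem_erase hi, h⟩)
    simp [this]

end Arrowhead

/-- A downward closed subset of `Fin n` with `k` elements is `{0, …, k - 1}`. -/
lemma Fin.iff_val_lt_card_filter {n : ℕ} (p : Fin n → Prop) [DecidablePred p]
    (hp : ∀ i j, i ≤ j → p j → p i) (i : Fin n) :
    p i ↔ (i : ℕ) < (Finset.univ.filter p).card := by
  constructor
  · intro hi
    have : Finset.Iic i ⊆ Finset.univ.filter p := fun j hj ↦ by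
      simpa using hp j i (Finset.mem_Iic.1 hj) hi
    have := Finset.card_le_card this
    rw [Fin.card_Iic] at this
    omega
  · intro hi
    by_contra h
    have : Finset.univ.filter p ⊆ Finset.Iio i := fun j hj ↦ by
      rw [Finset.mem_Iio]
      by_contra hij
      exact h (hp i j (not_lt.1 hij) (by simpa using hj))
    have := Finset.card_le_card this
    rw [Fin.card_Iio] at this
    omega

lemma exists_pos_le_of_ne_zero {ι : Type*} [Finite ι] (f : ι → ℝ) (hf : ∀ i, 0 ≤ f i) :
    ∃ c > 0, ∀ i, f i ≠ 0 → c ≤ f i := by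
  cases nonempty_fintype ι
  rcases (Finset.univ.filter fun i ↦ f i ≠ 0).eq_empty_or_nonempty with h | h
  · refine ⟨1, one_pos, fun i hi ↦ ?_⟩
    simpa using (Finset.filter_eq_empty_iff.1 h) (Finset.mem_univ i) hi
  · obtain ⟨k, hk, hmin⟩ := Finset.exists_min_image _ f h
    exact ⟨f k, (hf k).lt_of_ne' (Finset.mem_filter.1 hk).2,
      fun i hi ↦ hmin i (by simpa using hi)⟩

lemma not_rankCase1_and_rankCase2 {n l : ℕ} (hn : 2 ≤ n) (hl : l ≤ n - 1) {C₀ : ℝ} (hC₀ : 0 < C₀)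
    {A : Matrix (Fin n) (Fin n) ℝ} {lst : Fin n} :
    ¬ (RankCase1 n l C₀ A lst ∧ RankCase2 n l C₀ A lst) := by
  rintro ⟨⟨-, hzero, -, htip⟩, hpos, -, -, htip'⟩
  rcases Nat.eq_zero_or_pos l with rfl | hlpos
  · simp at htip htip'
    linarith
  · have h0 := hzero ⟨l - 1, by omega⟩ (by simp; omega) (by simp; omega)
    have h1 := hpos ⟨l - 1, by omega⟩ (by simp; omega)
    linarith

/-- **Lemma 2.5** (rank dichotomy).  Let `â ≥ 0` be an `n × n` real symmetric positive
semidefinite matrix of rank `l ≤ n-1` whose upper-left `(n-1) × (n-1)` block is diagonal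
with `â₁₁ ≥ â₂₂ ≥ … ≥ â_{n-1,n-1}`.  Then there is a constant `C₀ > 0` such that exactly
one of CASE 1 and CASE 2 holds. -/
theorem rank_dichotomy
    (n : ℕ) (hn : 2 ≤ n) (l : ℕ) (hl : l ≤ n - 1)
    (A : Matrix (Fin n) (Fin n) ℝ) (hpsd : A.PosSemidef) (hrank : A.rank = l)
    (lst : Fin n) (hlst : (lst : ℕ) = n - 1)
    (hdiag : ∀ i j : Fin n, (i : ℕ) < n - 1 → (j : ℕ) < n - 1 → i ≠ j → A i j = 0)
    (hord : ∀ i j : Fin n, (i : ℕ) ≤ (j : ℕ) → (j : ℕ) < n - 1 → A j j ≤ A i i) :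
    ∃ C₀ > (0 : ℝ), Xor' (RankCase1 n l C₀ A lst) (RankCase2 n l C₀ A lst) := by
  have hne (i : Fin n) : i ≠ lst ↔ (i : ℕ) < n - 1 := by
    rw [Ne, Fin.ext_iff]
    omega
  have hdiag' : ∀ i j, i ≠ lst → j ≠ lst → i ≠ j → A i j = 0 := fun i j hi hj ↦
    hdiag i j ((hne i).1 hi) ((hne j).1 hj)
  have hcard := rank_eq_card_add_ite_arrowSchur hpsd hdiag'
  rw [hrank] at hcard
  have hsupp (i : Fin n) := Fin.iff_val_lt_card_filter (fun i ↦ i ≠ lst ∧ A i i ≠ 0)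
    (fun i j hij hj ↦ by
      have hjn := (hne j).1 hj.1
      have hle := hord i j hij hjn
      have hjpos := lt_of_le_of_ne' (hpsd.diag_nonneg (i := j)) hj.2
      exact ⟨(hne i).2 (lt_of_le_of_lt hij hjn), by linarith⟩) i
  obtain ⟨C₀, hC₀, hmin⟩ := exists_pos_le_of_ne_zero _ (arrowPivot_nonneg hpsd hdiag')
  have hminDiag (i : Fin n) (hi : i ≠ lst ∧ A i i ≠ 0) : C₀ ≤ A i i := by
    simpa [arrowPivot, hi.1] using hmin i (by simpa [arrowPivot, hi.1] using hi.2)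
  have hzero (i : Fin n) (hi : i ≠ lst) (h : ¬ (i ≠ lst ∧ A i i ≠ 0)) : A i i = 0 := by
    simpa [hi] using h
  refine ⟨C₀, hC₀, (xor_iff_or_and_not_and _ _).2
    ⟨?_, not_rankCase1_and_rankCase2 hn hl hC₀⟩⟩
  by_cases hs : arrowSchur A lst = 0
  · rw [if_pos hs, add_zero] at hcard
    rw [← hcard] at hsupp
    have hdiagZero (i : Fin n) (h1 : l + 1 ≤ (i : ℕ) + 1) (h2 : (i : ℕ) + 1 ≤ n - 1) :
        A i i = 0 :=
      hzero i ((hne i).2 (by omega)) (by rw [hsupp]; omega)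
    refine Or.inr ⟨fun i hi ↦ hminDiag i ((hsupp i).2 hi), hdiagZero, fun i h1 h2 ↦
      hpsd.apply_eq_zero_of_diag_eq_zero (hdiagZero i h1 h2) lst, ?_⟩
    rw [arrowSchur_eq_of_support (Finset.univ.filter fun i : Fin n ↦ (i : ℕ) + 1 ≤ l)
      (fun i ↦ by simpa [Nat.succ_le_iff] using (hsupp i).symm)] at hs
    linarith
  · rw [if_neg hs] at hcard
    have hsupp' (i : Fin n) : (i ≠ lst ∧ A i i ≠ 0) ↔ (i : ℕ) + 1 + 1 ≤ l := by
      rw [hsupp]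
      omega
    have hdiagZero (i : Fin n) (h1 : l ≤ (i : ℕ) + 1) (h2 : (i : ℕ) + 1 ≤ n - 1) :
        A i i = 0 :=
      hzero i ((hne i).2 (by omega)) (by rw [hsupp']; omega)
    refine Or.inl ⟨fun i hi ↦ hminDiag i ((hsupp' i).2 hi), hdiagZero, fun i h1 h2 ↦
      hpsd.apply_eq_zero_of_diag_eq_zero (hdiagZero i h1 h2) lst, ?_⟩
    rw [← arrowSchur_eq_of_support (Finset.univ.filter fun i : Fin n ↦ (i : ℕ) + 1 + 1 ≤ l)
      (fun i ↦ by simpa using (hsupp' i).symm)]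
    simpa [arrowPivot] using hmin lst (by simpa [arrowPivot] using hs)
end
end

section
/- Let l ≥ 1, let d₁,…,d_l < 0 and b₁,…,b_l, d_n ∈ ℝ, let ε > 0, and let M be the (symmetric) n×n matrix with diagonal entries d₁−ε, …, d_l−ε in positions 1,…,l, entries −ε in positions l+1,…,n−1, diagonal entry d_n−ε in position n, off-diagonal entries M_{in} = M_{ni} = b_i for 1 ≤ i ≤ l, and all other off-diagonal entries zero. If C := d_n − ε − Σ_{i=1}^{l} b_i²/(d_i−ε) < 0, then M is invertible and M^{−1} ≤ diag(1/(d₁−ε), …, 1/(d_l−ε), 0, …, 0, 0) in the sense of symmetric matrices; in particular, for every v ∈ ℝⁿ one has vᵀ M^{−1} v ≤ Σ_{i=1}^{l} v_i²/(d_i−ε). -/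
noncomputable section

open Matrix

/-- The matrix `M` of Lemma 4.16 (0-based indices: positions `0,…,l-1` carry `dᵢ - ε`,
positions `l,…,n-2` carry `-ε`, the last position carries `d_n - ε`; the only nonzero
off-diagonal entries are `M_{i,last} = M_{last,i} = bᵢ` for `i < l`). -/
def case2Matrix (n l : ℕ) (d b : Fin n → ℝ) (ε : ℝ) (lst : Fin n) :
    Matrix (Fin n) (Fin n) ℝ :=
  Matrix.of fun i j =>
    if i = j then (if (i : ℕ) < l ∨ i = lst then d i - ε else -ε)
    else if (i : ℕ) < l ∧ j = lst then b i
    else if (j : ℕ) < l ∧ i = lst then b j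
    else 0

/-- The direction of the rank-one term of the inverse of `case2Matrix`. -/
def case2Vector (n l : ℕ) (d b : Fin n → ℝ) (ε : ℝ) (lst : Fin n) : Fin n → ℝ :=
  fun i => if (i : ℕ) < l then -(b i / (d i - ε)) else if i = lst then 1 else 0

/-- The diagonal term of the inverse of `case2Matrix`. -/
def case2Diag (n l : ℕ) (d : Fin n → ℝ) (ε : ℝ) (lst : Fin n) : Fin n → ℝ :=
  fun i => if (i : ℕ) < l then (d i - ε)⁻¹ else if i = lst then 0 else -ε⁻¹

theorem case2Matrix_mulVec_case2Vector {n l : ℕ} {d b : Fin n → ℝ} {ε : ℝ} {lst : Fin n}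
    (hd : ∀ i : Fin n, (i : ℕ) < l → d i - ε ≠ 0) (hl : ¬ (lst : ℕ) < l) :
    case2Matrix n l d b ε lst *ᵥ case2Vector n l d b ε lst =
      Pi.single lst (d lst - ε -
        ∑ i ∈ Finset.univ.filter (fun i : Fin n => (i : ℕ) < l), (b i) ^ 2 / (d i - ε)) := by
  ext i
  simp only [Matrix.mulVec, dotProduct]
  by_cases hi : i = lst
  · subst hi
    have key (j : Fin n) : case2Matrix n l d b ε i i j * case2Vector n l d b ε i j =
        (if j = i then d i - ε else 0) -
          (if (j : ℕ) < l then (b j) ^ 2 / (d j - ε) else 0) := by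
      by_cases hj : j = i
      · subst hj
        simp [case2Matrix, case2Vector, hl]
      · by_cases hjl : (j : ℕ) < l
        · simp [case2Matrix, case2Vector, hl, hj, Ne.symm hj, hjl]
          ring
        · simp [case2Matrix, case2Vector, hl, hj, Ne.symm hj, hjl]
    simp [key, Finset.sum_sub_distrib, Finset.sum_filter]
  · have key (j : Fin n) : case2Matrix n l d b ε lst i j * case2Vector n l d b ε lst j =
        (if j = i then (if (i : ℕ) < l then -b i else 0) else 0) +
          (if j = lst then (if (i : ℕ) < l then b i else 0) else 0) := by
      by_cases hj : j = i
      · subst hj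
        by_cases hjl : (j : ℕ) < l
        · have := hd j hjl
          simp [case2Matrix, case2Vector, hi, hjl]
          field_simp
        · simp [case2Matrix, case2Vector, hi, hjl]
      · by_cases hjl : j = lst
        · subst hjl
          simp [case2Matrix, case2Vector, hl, hi, hj]
        · simp [case2Matrix, hi, hj, Ne.symm hj, hjl]
    simp only [key, Finset.sum_add_distrib, Finset.sum_ite_eq', Finset.mem_univ, if_true]
    split_ifs <;> simp [hi]

theorem case2Matrix_mul_diagonal_add_vecMulVec {n l : ℕ} {d b : Fin n → ℝ} {ε : ℝ}
    {lst : Fin n} (hε : ε ≠ 0) (hd : ∀ i : Fin n, (i : ℕ) < l → d i - ε ≠ 0)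
    (hl : ¬ (lst : ℕ) < l)
    (hC : d lst - ε -
      ∑ i ∈ Finset.univ.filter (fun i : Fin n => (i : ℕ) < l), (b i) ^ 2 / (d i - ε) ≠ 0) :
    case2Matrix n l d b ε lst * (Matrix.diagonal (case2Diag n l d ε lst) +
      (d lst - ε - ∑ i ∈ Finset.univ.filter (fun i : Fin n => (i : ℕ) < l),
        (b i) ^ 2 / (d i - ε))⁻¹ •
      Matrix.vecMulVec (case2Vector n l d b ε lst) (case2Vector n l d b ε lst)) = 1 := by
  rw [Matrix.mul_add, Matrix.mul_smul, Matrix.mul_vecMulVec,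
    case2Matrix_mulVec_case2Vector hd hl]
  ext i j
  rw [Matrix.add_apply, Matrix.smul_apply, Matrix.mul_diagonal, Matrix.vecMulVec_apply,
    smul_eq_mul, Pi.single_apply, ← mul_assoc, mul_ite, mul_zero, inv_mul_cancel₀ hC]
  by_cases hj : j = lst
  · subst hj
    simp [case2Diag, case2Vector, hl, Matrix.one_apply]
  · by_cases hij : i = j
    · subst hij
      by_cases hil : (i : ℕ) < l
      · simp [case2Matrix, case2Diag, hj, hil, hd i hil]
      · simp [case2Matrix, case2Diag, hj, hil, hε]
    · by_cases hi : i = lst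
      · subst hi
        by_cases hjl : (j : ℕ) < l
        · simp [case2Matrix, case2Diag, case2Vector, hij, hl, hjl]
          ring
        · simp [case2Matrix, case2Vector, hij, hj, hl, hjl]
      · simp [case2Matrix, hij, hi, hj]

/-- **The matrix inequality in the proof of Lemma 4.16.**  If
`C = d_n - ε - Σ_{i<l} bᵢ²/(dᵢ-ε) < 0` (with `dᵢ < 0` for `i < l` and `ε > 0`), then `M`
is invertible and `M⁻¹ ≤ diag(1/(d₁-ε), …, 1/(d_l-ε), 0, …, 0)` in the sense of symmetric
matrices; in particular `vᵀ M⁻¹ v ≤ Σ_{i<l} vᵢ²/(dᵢ-ε)` for every `v ∈ ℝⁿ`. -/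
theorem case2Matrix_inverse_bound
    (n l : ℕ) (hl : 1 ≤ l) (hln : l < n)
    (d b : Fin n → ℝ) (hd : ∀ i : Fin n, (i : ℕ) < l → d i < 0)
    (ε : ℝ) (hε : 0 < ε)
    (lst : Fin n) (hlst : (lst : ℕ) = n - 1)
    (hC : d lst - ε -
        ∑ i ∈ Finset.univ.filter (fun i : Fin n => (i : ℕ) < l), (b i) ^ 2 / (d i - ε)
      < 0) :
    IsUnit (case2Matrix n l d b ε lst).det ∧
    (Matrix.diagonal (fun i : Fin n => if (i : ℕ) < l then (d i - ε)⁻¹ else 0) -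
      (case2Matrix n l d b ε lst)⁻¹).PosSemidef ∧
    ∀ v : Fin n → ℝ,
      v ⬝ᵥ ((case2Matrix n l d b ε lst)⁻¹).mulVec v ≤
        ∑ i ∈ Finset.univ.filter (fun i : Fin n => (i : ℕ) < l), (v i) ^ 2 / (d i - ε) := by
  have hl' : ¬ (lst : ℕ) < l := by omega
  have hd' (i : Fin n) (hi : (i : ℕ) < l) : d i - ε ≠ 0 := 
    (sub_neg.mpr ((hd i hi).trans hε)).ne
  have hMN := case2Matrix_mul_diagonal_add_vecMulVec hε.ne' hd' hl' hC.ne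
  have hpsd : (Matrix.diagonal (fun i : Fin n => if (i : ℕ) < l then (d i - ε)⁻¹ else 0) -
      (case2Matrix n l d b ε lst)⁻¹).PosSemidef := by
    rw [Matrix.inv_eq_right_inv hMN, ← sub_sub, Matrix.diagonal_sub, sub_eq_add_neg, ← neg_smul]
    refine (Matrix.PosSemidef.diagonal fun i => ?_).add
      ((Matrix.posSemidef_vecMulVec_self_star (case2Vector n l d b ε lst)).smul
        (neg_nonneg.mpr (inv_nonpos.mpr hC.le)))
    simp only [case2Diag, Pi.zero_apply]
    split_ifs <;> simp [hε.le]
  refine ⟨Matrix.isUnit_det_of_right_inverse hMN, hpsd, fun v => ?_⟩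
  have hv := hpsd.dotProduct_mulVec_nonneg v
  rw [star_trivial, Matrix.sub_mulVec, dotProduct_sub, sub_nonneg] at hv
  refine hv.trans_eq ?_
  rw [Finset.sum_filter, dotProduct]
  refine Finset.sum_congr rfl fun i _ => ?_
  rw [Matrix.mulVec_diagonal]
  split_ifs <;> ring
end
end
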